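/- arXiv:2012.15447 — 3 statements merged into one kernel-verified Lean document; each statement's English description precedes it below -/
import Mathlib

section
/- Let I_1, …, I_r be strongly stable ideals in S = K[x_1, …, x_n] over a field K, where each I_i is minimally generated by monomials u_{i,1}, …, u_{i,s_i}, all of the same degree d_i. Let φ : S[T_{i,j}] → S[t_1, …, t_r] be the S-algebra homomorphism with T_{i,j} ↦ u_{i,j}·t_i, and let φ' : K[T_{i,j}] → K[x_1, …, x_n, t_1, …, t_r] be the K-algebra map T_{i,j} ↦ u_{i,j}·t_i. Then the defining ideal ker φ of the multi-Rees algebra is generated by the set { x_i·T_{l,k} − x_j·T_{l,k'} : i < j and x_i·u_{l,k} = x_j·u_{l,k'} } together with ker φ', regarded as a subset of S[T_{i,j}] via the natural inclusion K[T_{i,j}] ⊆ S[T_{i,j}]; that is, the multi-Rees algebra R(I_1 ⊕ … ⊕ I_r) is of fiber type. -/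
/-- A marked binomial: the difference of two monomials (given by exponent vectors),
with `head` chosen as the marked term. -/
structure MarkedBinomial (V : Type*) where
  head : V →₀ ℕ
  tail : V →₀ ℕ

/-- The polynomial associated to a marked binomial. -/
noncomputable def MarkedBinomial.toPoly {V : Type*} (K : Type*) [Field K]
    (g : MarkedBinomial V) : MvPolynomial V K :=
  MvPolynomial.monomial g.head 1 - MvPolynomial.monomial g.tail 1

/-- Transport a marked binomial along a map of variables. -/
noncomputable def MarkedBinomial.map {V W : Type*} (f : V → W) (g : MarkedBinomial V) :
    MarkedBinomial W :=
  ⟨Finsupp.mapDomain f g.head, Finsupp.mapDomain f g.tail⟩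

/-- A monomial order on the exponent vectors `V →₀ ℕ`: a strict total order, compatible
with addition, for which `1` (the zero exponent vector) is the smallest monomial. -/
structure MonomialOrd (V : Type*) where
  gt : (V →₀ ℕ) → (V →₀ ℕ) → Prop
  irrefl : ∀ m, ¬ gt m m
  trans : ∀ {m₁ m₂ m₃}, gt m₁ m₂ → gt m₂ m₃ → gt m₁ m₃
  total : ∀ m₁ m₂, m₁ ≠ m₂ → gt m₁ m₂ ∨ gt m₂ m₁
  add_right : ∀ {m₁ m₂} (m₃), gt m₁ m₂ → gt (m₁ + m₃) (m₂ + m₃)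
  gt_zero : ∀ m, m ≠ 0 → gt m 0

/-- `m` is the initial (leading) exponent of `f` with respect to the strict order `gt`. -/
def IsInitialTerm {V K : Type*} [Field K] (gt : (V →₀ ℕ) → (V →₀ ℕ) → Prop)
    (f : MvPolynomial V K) (m : V →₀ ℕ) : Prop :=
  m ∈ f.support ∧ ∀ m' ∈ f.support, m' ≠ m → gt m m'

/-- A set `G` of marked binomials is a Gröbner basis of the ideal `J` with respect to the
order `gt`, with the marked terms as initial terms: `G ⊆ J`, each marked term is the
initial term of its binomial, and the marked terms generate the initial ideal of `J`. -/
def IsMarkedGB {V K : Type*} [Field K] (gt : (V →₀ ℕ) → (V →₀ ℕ) → Prop)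
    (G : Set (MarkedBinomial V)) (J : Ideal (MvPolynomial V K)) : Prop :=
  (∀ g ∈ G, g.toPoly K ∈ J) ∧ (∀ g ∈ G, gt g.head g.tail) ∧
    Ideal.span ((fun g => (MvPolynomial.monomial g.head (1 : K) : MvPolynomial V K)) '' G) =
      Ideal.span {p : MvPolynomial V K |
        ∃ f ∈ J, f ≠ 0 ∧ ∃ m, IsInitialTerm gt f m ∧ p = MvPolynomial.monomial m (1 : K)}

/-- One-step reduction of a monomial (exponent vector) with respect to a collection of
marked binomials: replace an occurrence of a marked term by the corresponding tail. -/
def Reduces {V : Type*} (G : Set (MarkedBinomial V)) (m m' : V →₀ ℕ) : Prop :=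
  ∃ g ∈ G, g.head ≤ m ∧ m' = m - g.head + g.tail

/-- One-step reduction of a polynomial with respect to a collection of marked binomials. -/
noncomputable def PolyReduces {V K : Type*} [Field K] (G : Set (MarkedBinomial V))
    (f f' : MvPolynomial V K) : Prop :=
  ∃ g ∈ G, ∃ m ∈ f.support, g.head ≤ m ∧
    f' = f - MvPolynomial.monomial (m - g.head) (MvPolynomial.coeff m f) * g.toPoly K

/-- The image monomial (in the `W`-variables) of a monomial `T` in the `V`-variables under
the monomial map sending the variable `v` to the monomial with exponent vector `u v`. -/
noncomputable def fiberMap {V W : Type*} (u : V → (W →₀ ℕ)) (T : V →₀ ℕ) : W →₀ ℕ :=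
  T.sum fun v e => e • u v

/-- `T` is a sink of the fiber graph over the multidegree `μ` (with respect to the
marked binomials `G` and the monomial map determined by `u`): it lies in the fiber and
has no outgoing edge inside the fiber. -/
noncomputable def IsFiberSink {V W : Type*} (G : Set (MarkedBinomial V)) (u : V → (W →₀ ℕ))
    (μ : W →₀ ℕ) (T : V →₀ ℕ) : Prop :=
  fiberMap u T = μ ∧ ∀ T', Reduces G T T' → fiberMap u T' ≠ μ

/-- `I` is a monomial ideal. -/
def IsMonomialIdeal {n : ℕ} {K : Type*} [Field K] (I : Ideal (MvPolynomial (Fin n) K)) : Prop :=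
  ∃ M : Set (Fin n →₀ ℕ), I = Ideal.span ((fun m => (MvPolynomial.monomial m (1 : K))) '' M)

/-- `I` is a strongly stable (Borel) ideal: a monomial ideal such that whenever `x_i`
divides a monomial `m ∈ I` and `j < i`, also `x_j · m / x_i ∈ I`. -/
def StronglyStable {n : ℕ} {K : Type*} [Field K] (I : Ideal (MvPolynomial (Fin n) K)) : Prop :=
  IsMonomialIdeal I ∧ ∀ m : Fin n →₀ ℕ, MvPolynomial.monomial m (1 : K) ∈ I →
    ∀ i j : Fin n, j < i → m i ≠ 0 →
      MvPolynomial.monomial (m - Finsupp.single i 1 + Finsupp.single j 1) (1 : K) ∈ I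

/-- The smallest strongly stable ideal containing the given monomials. -/
noncomputable def smallestStronglyStable {n : ℕ} (K : Type*) [Field K]
    (Ms : Set (Fin n →₀ ℕ)) : Ideal (MvPolynomial (Fin n) K) :=
  sInf {I | StronglyStable I ∧ ∀ m ∈ Ms, MvPolynomial.monomial m (1 : K) ∈ I}

/-- The minimal monomial generators of an ideal generated in the single degree `d`:
the degree-`d` monomials lying in `I`. -/
def MinGens {n : ℕ} {K : Type*} [Field K] (I : Ideal (MvPolynomial (Fin n) K)) (d : ℕ) :
    Set (Fin n →₀ ℕ) :=
  {m | (m.sum fun _ e => e) = d ∧ MvPolynomial.monomial m (1 : K) ∈ I}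

/-- `u ≻_rlex v` (reverse lexicographic, `x_1 > … > x_n`, for exponent vectors of equal
total degree): at the largest index where they differ, `u` has the smaller exponent. -/
def RlexGt {n : ℕ} (u v : Fin n →₀ ℕ) : Prop :=
  ∃ k : Fin n, u k < v k ∧ ∀ l : Fin n, k < l → u l = v l

/-- The (degree-)reverse lexicographic order on monomials of `K[V]` induced by the strict
variable order `vgt` (where `vgt k l` means the variable `k` is greater than `l`). -/
def VarRevlexGt {V : Type*} (vgt : V → V → Prop) (m m' : V →₀ ℕ) : Prop :=
  (m.sum fun _ e => e) > (m'.sum fun _ e => e) ∨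
    ((m.sum fun _ e => e) = (m'.sum fun _ e => e) ∧
      ∃ k, m k < m' k ∧ ∀ l, vgt k l → m l = m' l)

/-- The minimal monomial generators of the strongly stable ideal `B(x_a x_b)` (`a ≤ b`):
the monomials `x_i x_j` with `i ≤ j`, `i ≤ a`, `j ≤ b`. -/
def BM {n : ℕ} (a b : Fin n) : Set (Fin n →₀ ℕ) :=
  {m | ∃ i j : Fin n, i ≤ j ∧ i ≤ a ∧ j ≤ b ∧ m = Finsupp.single i 1 + Finsupp.single j 1}

/-- The minimal monomial generators of `B(x_c x_d)` not in `B(x_a x_b)` (for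
`c < a ≤ b < d`): the monomials `x_i x_j` with `i ≤ c` and `b < j ≤ d`. -/
def BN {n : ℕ} (b c d : Fin n) : Set (Fin n →₀ ℕ) :=
  {m | ∃ i j : Fin n, i ≤ c ∧ b < j ∧ j ≤ d ∧ m = Finsupp.single i 1 + Finsupp.single j 1}

/-- `u ≻_mrlex v`: every element of `B_N` is greater than every element of `B_M`, and
within `B_M` (resp. `B_N`) the order agrees with `≻_rlex`. -/
def MrlexGt {n : ℕ} (a b c d : Fin n) (u v : Fin n →₀ ℕ) : Prop :=
  (u ∈ BN b c d ∧ v ∈ BM a b) ∨ (u ∈ BM a b ∧ v ∈ BM a b ∧ RlexGt u v) ∨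
    (u ∈ BN b c d ∧ v ∈ BN b c d ∧ RlexGt u v)

/-- The collection `G₁` of marked binomials `T_u T_v − T_{u'} T_{v'}` with `u v = u' v'`
and `u, v ≻_rlex v'`, marked at `T_u T_v`. -/
def G1 {n : ℕ} (a b c d : Fin n) : Set (MarkedBinomial ↥(BM a b ∪ BN b c d)) :=
  {g | ∃ u v u' v' : ↥(BM a b ∪ BN b c d),
    (u : Fin n →₀ ℕ) + (v : Fin n →₀ ℕ) = (u' : Fin n →₀ ℕ) + (v' : Fin n →₀ ℕ) ∧
    RlexGt (u : Fin n →₀ ℕ) (v' : Fin n →₀ ℕ) ∧ RlexGt (v : Fin n →₀ ℕ) (v' : Fin n →₀ ℕ) ∧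
    g.head = Finsupp.single u 1 + Finsupp.single v 1 ∧
    g.tail = Finsupp.single u' 1 + Finsupp.single v' 1}

/-- The collection `G₂` of marked binomials `T_u T_v − T_{u'} T_{v'}` with `u v = u' v'`
and `u, v ≻_mrlex v'`, marked at `T_u T_v`. -/
def G2 {n : ℕ} (a b c d : Fin n) : Set (MarkedBinomial ↥(BM a b ∪ BN b c d)) :=
  {g | ∃ u v u' v' : ↥(BM a b ∪ BN b c d),
    (u : Fin n →₀ ℕ) + (v : Fin n →₀ ℕ) = (u' : Fin n →₀ ℕ) + (v' : Fin n →₀ ℕ) ∧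
    MrlexGt a b c d (u : Fin n →₀ ℕ) (v' : Fin n →₀ ℕ) ∧
    MrlexGt a b c d (v : Fin n →₀ ℕ) (v' : Fin n →₀ ℕ) ∧
    g.head = Finsupp.single u 1 + Finsupp.single v 1 ∧
    g.tail = Finsupp.single u' 1 + Finsupp.single v' 1}

/-- `w` is the smallest (with respect to the variable order induced by `≻_rlex`) variable
factor of the monomial `T` whose underlying monomial lies in `S`. -/
def IsLeastFactorIn {n : ℕ} {V : Set (Fin n →₀ ℕ)} (S : Set (Fin n →₀ ℕ))
    (T : ↥V →₀ ℕ) (w : ↥V) : Prop :=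
  w ∈ T.support ∧ (w : Fin n →₀ ℕ) ∈ S ∧
    ∀ v ∈ T.support, (v : Fin n →₀ ℕ) ∈ S →
      v = w ∨ RlexGt (v : Fin n →₀ ℕ) (w : Fin n →₀ ℕ)

/-- `m` is the `≻_rlex`-smallest element of `S` dividing `μ`. -/
def IsLeastDivisorIn {n : ℕ} (S : Set (Fin n →₀ ℕ)) (μ m : Fin n →₀ ℕ) : Prop :=
  m ∈ S ∧ m ≤ μ ∧ ∀ m' ∈ S, m' ≤ μ → m' = m ∨ RlexGt m' m

open MvPolynomial in
/-- A `K`-algebra map sending every variable to a monomial sends monomials to monomials. -/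
theorem aeval_monomial_monomial {V W K : Type*} [CommSemiring K] (e : V → (W →₀ ℕ))
    (m : V →₀ ℕ) :
    aeval (fun v => (monomial (e v) 1 : MvPolynomial W K)) (monomial m (1 : K)) =
      monomial (Finsupp.linearCombination ℕ e m) 1 := by
  induction m using Finsupp.induction_linear with
  | zero => simp
  | add f g hf hg =>
    rw [map_add, ← mul_one (1 : K), ← monomial_mul, ← monomial_mul, map_mul, mul_one, hf, hg]
  | single v k =>
    rw [aeval_monomial, Finsupp.prod_single_index (by simp), monomial_pow,
      Finsupp.linearCombination_single]
    simp

open MvPolynomial in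
/-- The kernel of a linear map sending monomials to monomials is contained in any ideal
containing the differences of monomials with equal image. -/
theorem mem_of_monomial_sub_mem {V W K : Type*} [CommRing K]
    (L : MvPolynomial V K →ₗ[K] MvPolynomial W K) (f : (V →₀ ℕ) → (W →₀ ℕ))
    (hL : ∀ m, L (monomial m 1) = monomial (f m) 1) (J : Ideal (MvPolynomial V K))
    (hJ : ∀ m m', f m = f m' → (monomial m 1 - monomial m' 1 : MvPolynomial V K) ∈ J)
    {p : MvPolynomial V K} (hp : L p = 0) : p ∈ J := by
  classical
  let M : MvPolynomial W K →ₗ[K] MvPolynomial V K :=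
    (basisMonomials W K).constr K fun w => monomial (Function.invFun f w) 1
  have hM : ∀ w, M (monomial w 1) = monomial (Function.invFun f w) 1 := fun w => by
    simpa using (basisMonomials W K).constr_basis K
      (fun w => (monomial (Function.invFun f w) 1 : MvPolynomial V K)) w
  have key : ∀ q : MvPolynomial V K, q - M (L q) ∈ J := by
    intro q
    induction q using MvPolynomial.induction_on' with
    | monomial m c =>
      have hc : (monomial m c : MvPolynomial V K) = c • monomial m 1 := by
        simp [smul_monomial]
      rw [hc, map_smul, map_smul, hL, hM, ← smul_sub, smul_eq_C_mul]
      exact J.mul_mem_left _ (hJ _ _ (Function.invFun_eq ⟨m, rfl⟩).symm)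
    | add p q hp hq =>
      rw [map_add, map_add, add_sub_add_comm]
      exact J.add_mem hp hq
  simpa [hp] using key p

open MvPolynomial in
/-- Borel exchange on the generators of a strongly stable ideal generated in one degree. -/
theorem StronglyStable.exists_exchange {n : ℕ} {K ι : Type*} [Field K]
    {I : Ideal (MvPolynomial (Fin n) K)} (hSS : StronglyStable I) {d : ℕ}
    {u : ι → (Fin n →₀ ℕ)} (hdeg : ∀ k, (u k).degree = d)
    (hI : I = Ideal.span (Set.range fun k => monomial (u k) (1 : K)))
    {i j : Fin n} (hij : i < j) {k : ι} (hk : u k j ≠ 0) :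
    ∃ k', Finsupp.single i 1 + u k = Finsupp.single j 1 + u k' := by
  classical
  have hmem : monomial (u k) (1 : K) ∈ I := hI ▸ Ideal.subset_span ⟨k, rfl⟩
  have h := hSS.2 _ hmem j i hij hk
  have hle : Finsupp.single j 1 ≤ u k := by
    rw [Finsupp.single_le_iff]
    exact Nat.one_le_iff_ne_zero.2 hk
  obtain ⟨c, hc⟩ := exists_add_of_le hle
  rw [hc, add_tsub_cancel_left, hI, Set.range_comp' (fun m => monomial m (1 : K)) u,
    mem_ideal_span_monomial_image] at h
  obtain ⟨_, ⟨k', rfl⟩, hk'⟩ := h (c + Finsupp.single i 1) (by simp [support_monomial])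
  obtain ⟨e, he⟩ := exists_add_of_le hk'
  have he0 : e = 0 := by
    have h1 := congrArg Finsupp.degree he
    have h2 := congrArg Finsupp.degree hc
    simp only [map_add, hdeg, Finsupp.degree_single] at h1 h2
    rw [← Finsupp.degree_eq_zero_iff]
    omega
  refine ⟨k', ?_⟩
  rw [he0, add_zero] at he
  rw [hc, ← he]
  abel

/-- Two distinct exponent vectors of the same degree: at the last place where they differ
the smaller one can be compensated by an earlier entry. -/
theorem Finsupp.exists_lt_of_degree_eq {n : ℕ} {a b : Fin n →₀ ℕ} (hab : a ≠ b)
    (hdeg : a.degree = b.degree) :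
    ∃ i j, i < j ∧ ((a i < b i ∧ b j < a j) ∨ (b i < a i ∧ a j < b j)) := by
  classical
  have hne : (Finset.univ.filter fun j => a j ≠ b j).Nonempty := by
    by_contra h
    rw [Finset.not_nonempty_iff_eq_empty, Finset.filter_eq_empty_iff] at h
    exact hab (Finsupp.ext fun j => by simpa using h (Finset.mem_univ j))
  obtain ⟨j, hj, hmax⟩ := Finset.exists_max_image _ id hne
  simp only [Finset.mem_filter, Finset.mem_univ, true_and, id] at hj hmax
  rw [Finsupp.degree_eq_sum, Finsupp.degree_eq_sum] at hdeg
  rcases lt_or_gt_of_ne hj with h | h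
  · obtain ⟨i, -, hi⟩ : ∃ i ∈ Finset.univ, b i < a i := by
      by_contra! hc
      exact (Finset.sum_lt_sum hc ⟨j, Finset.mem_univ j, h⟩).ne hdeg
    exact ⟨i, j, lt_of_le_of_ne (hmax i hi.ne') (by rintro rfl; omega), Or.inr ⟨hi, h⟩⟩
  · obtain ⟨i, -, hi⟩ : ∃ i ∈ Finset.univ, a i < b i := by
      by_contra! hc
      exact (Finset.sum_lt_sum hc ⟨j, Finset.mem_univ j, h⟩).ne' hdeg
    exact ⟨i, j, lt_of_le_of_ne (hmax i hi.ne) (by rintro rfl; omega), Or.inl ⟨hi, h⟩⟩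

/-- The exponent vector of the image `u_{l,k} t_l` of the variable `T_{l,k}`. -/
noncomputable def reesExponent {n r : ℕ} {s : Fin r → ℕ}
    (u : (i : Fin r) → Fin (s i) → (Fin n →₀ ℕ)) (p : (i : Fin r) × Fin (s i)) :
    Fin n ⊕ Fin r →₀ ℕ :=
  Finsupp.mapDomain Sum.inl (u p.1 p.2) + Finsupp.single (Sum.inr p.1) 1

theorem sum_reesExponent_inl {n r : ℕ} {s : Fin r → ℕ} {d : Fin r → ℕ}
    {u : (i : Fin r) → Fin (s i) → (Fin n →₀ ℕ)} (hdeg : ∀ i j, (u i j).degree = d i)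
    (A : ((i : Fin r) × Fin (s i)) →₀ ℕ) :
    ∑ i, Finsupp.linearCombination ℕ (reesExponent u) A (Sum.inl i) =
      ∑ l, d l * Finsupp.linearCombination ℕ (reesExponent u) A (Sum.inr l) := by
  classical
  induction A using Finsupp.induction_linear with
  | zero => simp
  | add f g hf hg => simp [mul_add, Finset.sum_add_distrib, hf, hg]
  | single p k =>
    simp only [Finsupp.linearCombination_single, reesExponent, Finsupp.smul_apply,
      Finsupp.add_apply, Finsupp.mapDomain_apply Sum.inl_injective]
    have h0 : ∀ l, Finsupp.mapDomain (Sum.inl : _ → Fin n ⊕ Fin r) (u p.1 p.2) (Sum.inr l) = 0 :=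
      fun l => Finsupp.mapDomain_of_notMem_range _ _ (by simp)
    simp only [h0]
    simp [Finsupp.single_apply, ← Finset.mul_sum, ← Finsupp.degree_eq_sum, hdeg, mul_comm]

open MvPolynomial in
/-- Monomials `x^a T^A`, `x^b T^B` with equal image are congruent modulo any ideal containing
the linear syzygies and the relations of the special fiber. -/
theorem monomial_sub_monomial_mem {n r : ℕ} {K : Type*} [Field K] {s d : Fin r → ℕ}
    {u : (i : Fin r) → Fin (s i) → (Fin n →₀ ℕ)} (hdeg : ∀ i j, (u i j).degree = d i)
    (hex : ∀ (i j : Fin n) (l : Fin r) (k : Fin (s l)), i < j → u l k j ≠ 0 →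
      ∃ k', Finsupp.single i 1 + u l k = Finsupp.single j 1 + u l k')
    {J : Ideal (MvPolynomial (Fin n ⊕ ((i : Fin r) × Fin (s i))) K)}
    (hsyz : ∀ (i j : Fin n) (l : Fin r) (k k' : Fin (s l)), i < j →
      Finsupp.single i 1 + u l k = Finsupp.single j 1 + u l k' →
      X (Sum.inl i) * X (Sum.inr ⟨l, k⟩) - X (Sum.inl j) * X (Sum.inr ⟨l, k'⟩) ∈ J)
    (hfib : ∀ A B : ((i : Fin r) × Fin (s i)) →₀ ℕ,
      Finsupp.linearCombination ℕ (reesExponent u) A =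
        Finsupp.linearCombination ℕ (reesExponent u) B →
      rename Sum.inr (monomial A (1 : K)) - rename Sum.inr (monomial B (1 : K)) ∈ J)
    (a b : Fin n →₀ ℕ) (A B : ((i : Fin r) × Fin (s i)) →₀ ℕ)
    (h : a.mapDomain Sum.inl + Finsupp.linearCombination ℕ (reesExponent u) A =
      b.mapDomain Sum.inl + Finsupp.linearCombination ℕ (reesExponent u) B) :
    rename Sum.inl (monomial a (1 : K)) * rename Sum.inr (monomial A (1 : K)) -
      rename Sum.inl (monomial b (1 : K)) * rename Sum.inr (monomial B (1 : K)) ∈ J := by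
  classical
  induction hN : ∑ i, ((a i - b i) + (b i - a i)) using Nat.strong_induction_on
    generalizing a b A B with
  | _ N ih =>
  by_cases hab : a = b
  · subst hab
    rw [← mul_sub]
    exact J.mul_mem_left _ (hfib A B (add_left_cancel h))
  have hinl : ∀ i, a i + Finsupp.linearCombination ℕ (reesExponent u) A (Sum.inl i) =
      b i + Finsupp.linearCombination ℕ (reesExponent u) B (Sum.inl i) := fun i => by
    simpa [Finsupp.mapDomain_apply Sum.inl_injective] using DFunLike.congr_fun h (Sum.inl i)
  have hinr : ∀ l, Finsupp.linearCombination ℕ (reesExponent u) A (Sum.inr l) =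
      Finsupp.linearCombination ℕ (reesExponent u) B (Sum.inr l) := fun l => by
    simpa [Finsupp.mapDomain_of_notMem_range] using DFunLike.congr_fun h (Sum.inr l)
  have hdab : a.degree = b.degree := by
    have h1 := Finset.sum_congr rfl fun i (_ : i ∈ Finset.univ) => hinl i
    simp only [Finset.sum_add_distrib, sum_reesExponent_inl hdeg, hinr] at h1
    rw [Finsupp.degree_eq_sum, Finsupp.degree_eq_sum]
    exact add_right_cancel h1
  obtain ⟨i, j, hij, hlt⟩ := Finsupp.exists_lt_of_degree_eq hab hdab
  wlog hw : a i < b i ∧ b j < a j generalizing a b A B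
  · rw [← neg_sub]
    refine J.neg_mem (this b a B A h.symm ?_ (Ne.symm hab) (fun i => (hinl i).symm)
      (fun l => (hinr l).symm) hdab.symm hlt.symm (hlt.resolve_left hw))
    rw [← hN]
    exact Finset.sum_congr rfl fun i _ => add_comm _ _
  obtain ⟨hi, hj⟩ := hw
  obtain ⟨p, hpB, hpj⟩ : ∃ p ∈ B.support, u p.1 p.2 j ≠ 0 := by
    by_contra! hc
    have : Finsupp.linearCombination ℕ (reesExponent u) B (Sum.inl j) = 0 := by
      rw [Finsupp.linearCombination_apply, Finsupp.sum, Finsupp.finsetSum_apply]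
      refine Finset.sum_eq_zero fun p hp => ?_
      simp [reesExponent, Finsupp.mapDomain_apply Sum.inl_injective, hc p hp]
    have := hinl j
    omega
  obtain ⟨l, k⟩ := p
  obtain ⟨k', hk'⟩ := hex i j l k hij hpj
  obtain ⟨B', rfl⟩ : ∃ B', B = Finsupp.single ⟨l, k⟩ 1 + B' :=
    exists_add_of_le (Finsupp.single_le_iff.2
      (Nat.one_le_iff_ne_zero.2 (Finsupp.mem_support_iff.1 hpB)))
  obtain ⟨b', rfl⟩ : ∃ b', b = Finsupp.single i 1 + b' :=
    exists_add_of_le (Finsupp.single_le_iff.2 (by omega))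
  have hE : (Finsupp.single i 1).mapDomain Sum.inl + reesExponent u ⟨l, k⟩ =
      (Finsupp.single j 1).mapDomain Sum.inl + reesExponent u ⟨l, k'⟩ := by
    simp only [reesExponent, ← add_assoc, ← Finsupp.mapDomain_add, hk']
  have hrec := ih _ ?_ a (Finsupp.single j 1 + b') A (Finsupp.single ⟨l, k'⟩ 1 + B') ?_ rfl
  · have hmem := J.mul_mem_left (rename Sum.inl (monomial b' (1 : K)) *
      rename Sum.inr (monomial B' (1 : K))) (hsyz i j l k k' hij hk')
    convert J.sub_mem hrec hmem using 1
    have hx : ∀ {V : Type} (v : V) (m : V →₀ ℕ),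
        (monomial (Finsupp.single v 1 + m) 1 : MvPolynomial V K) = X v * monomial m 1 :=
      fun v m => by rw [X, monomial_mul, mul_one]
    simp only [hx, map_mul, rename_X]
    ring
  · rw [← hN]
    refine Finset.sum_lt_sum (fun x _ => ?_) ⟨i, Finset.mem_univ i, ?_⟩
    · simp only [Finsupp.add_apply, Finsupp.single_apply] at hi hj ⊢
      split_ifs at hi hj ⊢ <;> subst_vars <;> omega
    · simp only [Finsupp.add_apply, Finsupp.single_apply, if_neg hij.ne'] at hi ⊢
      simp at hi ⊢
      omega
  · rw [h]
    simp only [map_add, Finsupp.mapDomain_add, Finsupp.linearCombination_single, one_smul]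
    rw [add_add_add_comm, hE, add_add_add_comm]

/-- The multi-Rees algebra of a collection of strongly stable ideals,
each generated in a single degree, is of fiber type: the defining ideal `ker φ` is
generated by the linear syzygy binomials `x_i T_{l,k} − x_j T_{l,k'}` (for `i < j` with
`x_i u_{l,k} = x_j u_{l,k'}`) together with the toric ideal `ker φ'` of the special
fiber, included via `K[T_{i,j}] ⊆ S[T_{i,j}]`. -/
theorem multiRees_of_fiber_type {n r : ℕ} {K : Type} [Field K]
    (s : Fin r → ℕ) (d : Fin r → ℕ)
    (u : (i : Fin r) → Fin (s i) → (Fin n →₀ ℕ))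
    (hdeg : ∀ i j, ((u i j).sum fun _ e => e) = d i)
    (hmin : ∀ i, Function.Injective (u i))
    (I : Fin r → Ideal (MvPolynomial (Fin n) K))
    (hI : ∀ i, I i = Ideal.span (Set.range fun j => (MvPolynomial.monomial (u i j) (1 : K))))
    (hSS : ∀ i, StronglyStable (I i))
    (φ : MvPolynomial (Fin n ⊕ ((i : Fin r) × Fin (s i))) K →ₐ[K]
      MvPolynomial (Fin n ⊕ Fin r) K)
    (hφ : φ = MvPolynomial.aeval (Sum.elim
      (fun i => (MvPolynomial.X (Sum.inl i) : MvPolynomial (Fin n ⊕ Fin r) K))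
      (fun p => MvPolynomial.monomial
        (Finsupp.mapDomain Sum.inl (u p.1 p.2) + Finsupp.single (Sum.inr p.1) 1) 1)))
    (φ' : MvPolynomial ((i : Fin r) × Fin (s i)) K →ₐ[K] MvPolynomial (Fin n ⊕ Fin r) K)
    (hφ' : φ' = MvPolynomial.aeval (fun p => MvPolynomial.monomial
      (Finsupp.mapDomain Sum.inl (u p.1 p.2) + Finsupp.single (Sum.inr p.1) 1) 1)) :
    RingHom.ker φ.toRingHom =
      Ideal.span
        ({f : MvPolynomial (Fin n ⊕ ((i : Fin r) × Fin (s i))) K |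
            ∃ (i j : Fin n) (l : Fin r) (k k' : Fin (s l)), i < j ∧
              Finsupp.single i 1 + u l k = Finsupp.single j 1 + u l k' ∧
              f = MvPolynomial.X (Sum.inl i) * MvPolynomial.X (Sum.inr ⟨l, k⟩) -
                  MvPolynomial.X (Sum.inl j) * MvPolynomial.X (Sum.inr ⟨l, k'⟩)}
          ∪ (⇑(MvPolynomial.rename (Sum.inr :
                ((i : Fin r) × Fin (s i)) → Fin n ⊕ ((i : Fin r) × Fin (s i)))) ''
              ((RingHom.ker φ'.toRingHom :
                Ideal (MvPolynomial ((i : Fin r) × Fin (s i)) K)) :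
                Set (MvPolynomial ((i : Fin r) × Fin (s i)) K)))) := by
  classical
  have hdeg' : ∀ i j, (u i j).degree = d i := fun i j => hdeg i j
  have hφ'm : ∀ m, φ' (MvPolynomial.monomial m 1) =
      MvPolynomial.monomial (Finsupp.linearCombination ℕ (reesExponent u) m) 1 :=
    fun m => hφ' ▸ aeval_monomial_monomial (reesExponent u) m
  have hφr : ∀ q, φ (MvPolynomial.rename Sum.inr q) = φ' q := fun q => by
    rw [hφ, hφ', MvPolynomial.aeval_rename]
    rfl
  have hφl : ∀ a, φ (MvPolynomial.rename Sum.inl (MvPolynomial.monomial a 1)) =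
      MvPolynomial.monomial (a.mapDomain Sum.inl) 1 := fun a => by
    rw [← MvPolynomial.rename_monomial, hφ, MvPolynomial.aeval_rename, MvPolynomial.rename_eq_aeval]
    rfl
  have hsplit : ∀ m : Fin n ⊕ ((i : Fin r) × Fin (s i)) →₀ ℕ,
      ∃ a A, (MvPolynomial.monomial m 1 : MvPolynomial _ K) =
        MvPolynomial.rename Sum.inl (MvPolynomial.monomial a 1) *
          MvPolynomial.rename Sum.inr (MvPolynomial.monomial A 1) := fun m => by
    refine ⟨(Finsupp.sumFinsuppEquivProdFinsupp m).1, (Finsupp.sumFinsuppEquivProdFinsupp m).2, ?_⟩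
    rw [MvPolynomial.rename_monomial, MvPolynomial.rename_monomial, MvPolynomial.monomial_mul,
      mul_one]
    refine congrArg (fun m => MvPolynomial.monomial m (1 : K)) (Finsupp.ext ?_)
    rintro (x | x)
    · simp [Finsupp.mapDomain_apply Sum.inl_injective, Finsupp.mapDomain_of_notMem_range]
    · simp [Finsupp.mapDomain_apply Sum.inr_injective, Finsupp.mapDomain_of_notMem_range]
  choose a A hm using hsplit
  have hφm : ∀ m, φ (MvPolynomial.monomial m 1) = MvPolynomial.monomial
      ((a m).mapDomain Sum.inl + Finsupp.linearCombination ℕ (reesExponent u) (A m)) 1 :=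
    fun m => by rw [hm, map_mul, hφl, hφr, hφ'm, MvPolynomial.monomial_mul, mul_one]
  apply le_antisymm
  · intro p hp
    refine mem_of_monomial_sub_mem φ.toLinearMap _ hφm _ (fun m m' h => ?_) hp
    rw [hm m, hm m']
    refine monomial_sub_monomial_mem hdeg'
      (fun i j l k hij hk => (hSS l).exists_exchange (hdeg' l) (hI l) hij hk)
      (fun i j l k k' hij hk => Ideal.subset_span (Or.inl ⟨i, j, l, k, k', hij, hk, rfl⟩))
      (fun A B hAB => Ideal.subset_span (Or.inr ⟨_, ?_, map_sub _ _ _⟩)) _ _ _ _ h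
    change φ' _ = 0
    rw [map_sub, hφ'm, hφ'm, hAB, sub_self]
  · rw [Ideal.span_le]
    rintro f (⟨i, j, l, k, k', -, hk, rfl⟩ | ⟨q, hq, rfl⟩)
    · change φ _ = 0
      have h := congrArg (Finsupp.mapDomain (Sum.inl : Fin n → Fin n ⊕ Fin r)) hk
      simp only [Finsupp.mapDomain_add, Finsupp.mapDomain_single] at h
      simp only [hφ, map_sub, map_mul, MvPolynomial.aeval_X, Sum.elim_inl, Sum.elim_inr]
      simp only [MvPolynomial.X, MvPolynomial.monomial_mul, ← add_assoc, h, sub_self]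
    · exact (hφr q).trans hq
end

section
/- Let I be a monomial ideal of S = K[x_1, …, x_n] minimally generated by monomials all of the same degree, let φ_I : K[T_u : u a minimal generator of I] → S be the K-algebra map T_u ↦ u, and let < be a monomial order on K[T_u]. Let G be a finite collection of marked binomials contained in ker φ_I such that the marked term of each element of G is its <-initial term. Then G is a Gröbner basis of the toric ideal T(I) = ker φ_I with respect to < if and only if for every monomial μ ∈ S the fiber graph Γ_μ(I) with respect to G is either empty or has a unique sink. -/
open MvPolynomial

theorem fiberMap_add {V W : Type*} (u : V → (W →₀ ℕ)) (a b : V →₀ ℕ) :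
    fiberMap u (a + b) = fiberMap u a + fiberMap u b :=
  Finsupp.sum_add_index' (fun _ => zero_smul _ _) (fun _ _ _ => add_smul _ _ _)

/-- The toric map sends a monomial to the monomial of its multidegree. -/
theorem aeval_monomial_eq_monomial_fiberMap {V W K : Type*} [Field K] (u : V → (W →₀ ℕ))
    (T : V →₀ ℕ) (c : K) :
    aeval (fun p => monomial (u p) (1 : K)) (monomial T c) = monomial (fiberMap u T) c := by
  rw [aeval_monomial, fiberMap, monomial_finsupp_sum_index]
  simp [algebraMap_eq, monomial_pow]

theorem coeff_aeval_monomial {V W K : Type*} [Field K] [DecidableEq W]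
    (u : V → (W →₀ ℕ)) (f : MvPolynomial V K) (μ : W →₀ ℕ) :
    coeff μ (aeval (fun p => monomial (u p) (1 : K)) f) =
      ∑ T ∈ f.support, if fiberMap u T = μ then coeff T f else 0 := by
  conv_lhs => rw [f.as_sum, map_sum, coeff_sum]
  simp only [aeval_monomial_eq_monomial_fiberMap, coeff_monomial]

/-- Injectively indexed exponent vectors of a fixed degree are finite in number. -/
theorem finite_of_injective_of_degree_eq {P σ : Type*} [Finite σ] {d : ℕ} {u : P → (σ →₀ ℕ)}
    (hu : Function.Injective u) (hdeg : ∀ p, ((u p).sum fun _ e => e) = d) : Finite P := by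
  classical
  have := Fintype.ofFinite σ
  have hle : ∀ p, u p ∈ Set.Iic (Finsupp.equivFunOnFinite.symm fun _ : σ => d) := fun p i => by
    have h : (u p) i ≤ (u p).sum fun _ e => e := by
      rw [Finsupp.sum_fintype _ _ fun _ => rfl]
      exact Finset.single_le_sum (f := fun i => (u p) i) (fun _ _ => Nat.zero_le _)
        (Finset.mem_univ i)
    simpa [hdeg p] using h
  have := (Set.finite_Iic (Finsupp.equivFunOnFinite.symm fun _ : σ => d)).to_subtype
  exact Finite.of_injective (fun p => (⟨u p, hle p⟩ : Set.Iic _))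
    fun a b h => hu (congrArg Subtype.val h)

namespace MonomialOrd

variable {V : Type*} (ord : MonomialOrd V)

theorem eq_or_gt_of_le {a b : V →₀ ℕ} (h : a ≤ b) : a = b ∨ ord.gt b a := by
  obtain ⟨c, rfl⟩ := exists_add_of_le h
  rcases eq_or_ne c 0 with rfl | hc
  · simp
  · have := ord.add_right a (ord.gt_zero c hc)
    rw [zero_add, add_comm] at this
    exact Or.inr this

/-- A monomial order in finitely many variables is a well-order. -/
theorem wellFounded [Finite V] : WellFounded fun a b : V →₀ ℕ => ord.gt b a := by
  have : IsStrictOrder (V →₀ ℕ) fun a b => ord.gt b a :=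
    { irrefl := ord.irrefl, trans := fun _ _ _ h h' => ord.trans h' h }
  rw [RelEmbedding.wellFounded_iff_isEmpty]
  refine ⟨fun f => ?_⟩
  obtain ⟨i, j, hij, hle⟩ := wellQuasiOrdered_le (α := V →₀ ℕ) f
  have hgt : ord.gt (f i) (f j) := f.map_rel_iff.2 hij
  rcases ord.eq_or_gt_of_le hle with h | h
  · exact ord.irrefl _ (h ▸ hgt)
  · exact ord.irrefl _ (ord.trans h hgt)

end MonomialOrd

section Fiber

variable {V W : Type*} {u : V → (W →₀ ℕ)} {G : Set (MarkedBinomial V)}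

theorem fiberMap_reduction (hG : ∀ g ∈ G, fiberMap u g.head = fiberMap u g.tail)
    {g : MarkedBinomial V} (hg : g ∈ G) {T : V →₀ ℕ} (hT : g.head ≤ T) :
    fiberMap u (T - g.head + g.tail) = fiberMap u T := by
  rw [fiberMap_add, ← hG g hg, ← fiberMap_add, tsub_add_cancel_of_le hT]

/-- The sinks of a fiber graph are the monomials of the fiber divisible by no marked term. -/
theorem isFiberSink_iff (hG : ∀ g ∈ G, fiberMap u g.head = fiberMap u g.tail)
    {μ : W →₀ ℕ} {T : V →₀ ℕ} :
    IsFiberSink G u μ T ↔ fiberMap u T = μ ∧ ∀ g ∈ G, ¬ g.head ≤ T := by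
  refine and_congr_right fun hμ => ⟨fun h g hg hle => ?_, ?_⟩
  · exact h _ ⟨g, hg, hle, rfl⟩ ((fiberMap_reduction hG hg hle).trans hμ)
  · rintro h T' ⟨g, hg, hle, -⟩
    exact absurd hle (h g hg)

/-- Every nonempty fiber has a least monomial, and that monomial is a sink. -/
theorem exists_isFiberSink_forall_not_gt [Finite V] (ord : MonomialOrd V)
    (hG : ∀ g ∈ G, fiberMap u g.head = fiberMap u g.tail)
    (hmark : ∀ g ∈ G, ord.gt g.head g.tail) (T : V →₀ ℕ) :
    ∃ T₀, IsFiberSink G u (fiberMap u T) T₀ ∧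
      ∀ T', fiberMap u T' = fiberMap u T → ¬ ord.gt T₀ T' := by
  obtain ⟨T₀, hT₀, hmin⟩ :=
    ord.wellFounded.has_min {T' | fiberMap u T' = fiberMap u T} ⟨T, rfl⟩
  refine ⟨T₀, (isFiberSink_iff hG).2 ⟨hT₀, fun g hg hle => ?_⟩, hmin⟩
  refine hmin _ ((fiberMap_reduction hG hg hle).trans hT₀) ?_
  have h := ord.add_right (T₀ - g.head) (hmark g hg)
  rwa [add_tsub_cancel_of_le hle, add_comm g.tail] at h

end Fiber

section Binomial

variable {V K : Type*} [Field K]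

theorem coeff_head_toPoly {g : MarkedBinomial V} (h : g.head ≠ g.tail) :
    coeff g.head (g.toPoly K) = 1 := by
  classical
  simp [MarkedBinomial.toPoly, coeff_monomial, h.symm]

theorem isInitialTerm_toPoly (ord : MonomialOrd V) {g : MarkedBinomial V}
    (h : ord.gt g.head g.tail) : IsInitialTerm ord.gt (g.toPoly K) g.head := by
  classical
  have hne : g.head ≠ g.tail := fun e => ord.irrefl _ (e ▸ h)
  refine ⟨by simp [mem_support_iff, coeff_head_toPoly hne], fun m hm hmne => ?_⟩
  have : m = g.tail := by
    by_contra hmt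
    simp [MarkedBinomial.toPoly, coeff_monomial, Ne.symm hmne, Ne.symm hmt] at hm
  exact this ▸ h

theorem toPoly_ne_zero {g : MarkedBinomial V} (h : g.head ≠ g.tail) : g.toPoly K ≠ 0 :=
  fun h0 => by simpa [h0] using coeff_head_toPoly (K := K) h

theorem toPoly_mem_ker_iff {W : Type*} (u : V → (W →₀ ℕ)) (g : MarkedBinomial V) :
    aeval (fun p => monomial (u p) (1 : K)) (g.toPoly K) = 0 ↔
      fiberMap u g.head = fiberMap u g.tail := by
  rw [MarkedBinomial.toPoly, map_sub, aeval_monomial_eq_monomial_fiberMap,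
    aeval_monomial_eq_monomial_fiberMap, sub_eq_zero, monomial_eq_monomial_iff]
  simp

theorem monomial_mem_span_head_iff {G : Set (MarkedBinomial V)} {m : V →₀ ℕ} :
    monomial m (1 : K) ∈ Ideal.span ((fun g => monomial g.head (1 : K)) '' G) ↔
      ∃ g ∈ G, g.head ≤ m := by
  classical
  have : (fun g : MarkedBinomial V => monomial g.head (1 : K)) '' G =
      (fun s => monomial s (1 : K)) '' (MarkedBinomial.head '' G) := by
    rw [Set.image_image]
  rw [this, mem_ideal_span_monomial_image]
  simp [coeff_monomial]

end Binomial

/-- Let `I` be a monomial ideal minimally generated by monomials `u p`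
(`p ∈ P`), all of the same degree `d`, let `φ_I : K[T_p] → S` be the toric map
`T_p ↦ u p`, and let `G` be a finite collection of marked binomials contained in
`ker φ_I` whose marked terms are their initial terms with respect to a monomial order
`ord`. Then `G` is a Gröbner basis of `T(I) = ker φ_I` with respect to `ord` if and only
if for every monomial `μ` the fiber graph `Γ_μ(I)` with respect to `G` is either empty
or has a unique sink. -/
theorem markedGB_iff_fiberGraph_unique_sink {n : ℕ} {K : Type} [Field K] {P : Type} (d : ℕ)
    (u : P → (Fin n →₀ ℕ)) (hu : Function.Injective u)
    (hdeg : ∀ p, ((u p).sum fun _ e => e) = d)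
    (I : Ideal (MvPolynomial (Fin n) K))
    (hI : I = Ideal.span (Set.range fun p => (MvPolynomial.monomial (u p) (1 : K))))
    (φ : MvPolynomial P K →ₐ[K] MvPolynomial (Fin n) K)
    (hφ : φ = MvPolynomial.aeval fun p => MvPolynomial.monomial (u p) (1 : K))
    (ord : MonomialOrd P)
    (G : Finset (MarkedBinomial P))
    (hGsub : ∀ g ∈ G, g.toPoly K ∈ RingHom.ker φ.toRingHom)
    (hGmark : ∀ g ∈ G, ord.gt g.head g.tail) :
    (IsMarkedGB ord.gt (G : Set (MarkedBinomial P)) (RingHom.ker φ.toRingHom) ↔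
      ∀ μ : Fin n →₀ ℕ,
        (∀ T : P →₀ ℕ, fiberMap u T ≠ μ) ∨
          (∃! T : P →₀ ℕ, IsFiberSink (G : Set (MarkedBinomial P)) u μ T)) := by
  classical
  have hfin : Finite P := finite_of_injective_of_degree_eq hu hdeg
  subst hφ
  have hmem : ∀ f : MvPolynomial P K,
      f ∈ RingHom.ker (aeval fun p => monomial (u p) (1 : K)).toRingHom ↔
        aeval (fun p => monomial (u p) (1 : K)) f = 0 := fun _ => Iff.rfl
  have hG : ∀ g ∈ (G : Set (MarkedBinomial P)), fiberMap u g.head = fiberMap u g.tail :=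
    fun g hg => (toPoly_mem_ker_iff u g).1 (hGsub g hg)
  constructor
  · rintro ⟨-, -, hspan⟩ μ
    refine or_iff_not_imp_left.2 fun hne => ?_
    push Not at hne
    obtain ⟨T, rfl⟩ := hne
    obtain ⟨T₀, hT₀, -⟩ := exists_isFiberSink_forall_not_gt ord hG hGmark T
    have key : ∀ a b, IsFiberSink (G : Set (MarkedBinomial P)) u (fiberMap u T) a →
        IsFiberSink (G : Set (MarkedBinomial P)) u (fiberMap u T) b → ¬ ord.gt a b := by
      intro a b ha hb hab
      have hin : monomial a (1 : K) ∈
          Ideal.span ((fun g => monomial g.head (1 : K)) '' (G : Set (MarkedBinomial P))) := by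
        rw [hspan]
        exact Ideal.subset_span ⟨(⟨a, b⟩ : MarkedBinomial P).toPoly K,
          (hmem _).2 ((toPoly_mem_ker_iff u _).2 (ha.1.trans hb.1.symm)),
          toPoly_ne_zero fun e : a = b => ord.irrefl _ (e ▸ hab),
          a, isInitialTerm_toPoly ord (g := ⟨a, b⟩) hab, rfl⟩
      obtain ⟨g, hg, hle⟩ := monomial_mem_span_head_iff.1 hin
      exact ((isFiberSink_iff hG).1 ha).2 g hg hle
    refine ⟨T₀, hT₀, fun T₁ hT₁ => ?_⟩
    by_contra hne
    rcases ord.total _ _ hne with h | h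
    · exact key _ _ hT₁ hT₀ h
    · exact key _ _ hT₀ hT₁ h
  · intro hsink
    refine ⟨hGsub, hGmark, le_antisymm (Ideal.span_mono ?_) (Ideal.span_le.2 ?_)⟩
    · rintro _ ⟨g, hg, rfl⟩
      exact ⟨g.toPoly K, hGsub g hg,
        toPoly_ne_zero fun e => ord.irrefl _ (e ▸ hGmark g hg : ord.gt g.tail g.tail),
        g.head, isInitialTerm_toPoly ord (hGmark g hg), rfl⟩
    · rintro _ ⟨f, hf, -, m, ⟨hm, hmax⟩, rfl⟩
      refine monomial_mem_span_head_iff.2 ?_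
      by_contra! hstd
      obtain ⟨T₀, hT₀, hmin⟩ := exists_isFiberSink_forall_not_gt ord hG hGmark m
      have hms : IsFiberSink (G : Set (MarkedBinomial P)) u (fiberMap u m) m :=
        (isFiberSink_iff hG).2 ⟨rfl, hstd⟩
      obtain rfl : m = T₀ := ((hsink _).resolve_left fun h => h m rfl).unique hms hT₀
      have hcoeff := coeff_aeval_monomial u f (fiberMap u m)
      rw [(hmem f).1 hf, coeff_zero, Finset.sum_eq_single m, if_pos rfl] at hcoeff
      · exact mem_support_iff.1 hm hcoeff.symm
      · exact fun m' hm' hne => if_neg fun h => hmin m' h (hmax m' hm' hne)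
      · exact fun h => absurd hm h
end

section
/- Let I = B(M,N) ⊆ S = K[x_1, …, x_n] be the strongly stable ideal with Borel generators M = x_a·x_b and N = x_c·x_d, where c < a ≤ b < d. Then the collection G₁ = { T_u T_v − T_{u'} T_{v'} : u, v, u', v' ∈ B_M ∪ B_N, u·v = u'·v', and u, v ≻_rlex v' }, with each binomial marked at T_u T_v, is a Gröbner basis of the toric ideal T(I) = ker φ_I with respect to the reverse lexicographic order ≻_rlex on K[T_u : u ∈ B_M ∪ B_N], with the marked terms as initial terms. -/
section RlexGt

variable {n : ℕ} {u v w : Fin n →₀ ℕ}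

theorem RlexGt.irrefl (u : Fin n →₀ ℕ) : ¬ RlexGt u u := fun ⟨_, hk, _⟩ => lt_irrefl _ hk

theorem RlexGt.trans (h : RlexGt u v) (h' : RlexGt v w) : RlexGt u w := by
  obtain ⟨k, hk, hk'⟩ := h
  obtain ⟨l, hl, hl'⟩ := h'
  rcases lt_trichotomy k l with hkl | rfl | hkl
  · exact ⟨l, by rwa [hk' l hkl], fun t ht => (hk' t (hkl.trans ht)).trans (hl' t ht)⟩
  · exact ⟨k, hk.trans hl, fun t ht => (hk' t ht).trans (hl' t ht)⟩
  · exact ⟨k, by rwa [← hl' k hkl], fun t ht => (hk' t ht).trans (hl' t (hkl.trans ht))⟩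

theorem RlexGt.total (h : u ≠ v) : RlexGt u v ∨ RlexGt v u := by
  have hne : (Finset.univ.filter fun k => u k ≠ v k).Nonempty := by
    obtain ⟨k, hk⟩ := DFunLike.ne_iff.mp h
    exact ⟨k, by simpa using hk⟩
  obtain ⟨k, hk, hmax⟩ := Finset.exists_max_image _ id hne
  simp only [Finset.mem_filter, Finset.mem_univ, true_and, id] at hk hmax
  have heq : ∀ l, k < l → u l = v l := fun l hl => by
    by_contra hc
    exact absurd (hmax l hc) (not_le.mpr hl)
  rcases lt_or_gt_of_ne hk with hlt | hlt
  · exact Or.inl ⟨k, hlt, heq⟩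
  · exact Or.inr ⟨k, hlt, fun l hl => (heq l hl).symm⟩

/-- In degree two, a monomial divisible by the largest variable of `x_p x_q` that is
rlex-greater than `x_p x_q` arises from it by replacing `x_p` with some `x_i`, `i < p`. -/
theorem RlexGt.exists_lt_of_apply_ne_zero {r t p q : Fin n} (hrt : r ≤ t) (hpq : p ≤ q)
    (h : RlexGt (Finsupp.single r 1 + Finsupp.single t 1 : Fin n →₀ ℕ)
      (Finsupp.single p 1 + Finsupp.single q 1))
    (hq : (Finsupp.single r 1 + Finsupp.single t 1 : Fin n →₀ ℕ) q ≠ 0) :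
    r < p ∧ t = q := by
  obtain ⟨k, hk, hk'⟩ := h
  have hkt := hk' t
  have hkq := hk' q
  have hkr := hk' r
  simp only [Finsupp.add_apply, Finsupp.single_apply] at *
  grind

end RlexGt

theorem VarRevlexGt.irrefl {V : Type*} (vgt : V → V → Prop) (m : V →₀ ℕ) :
    ¬ VarRevlexGt vgt m m := by
  rintro (h | ⟨-, k, hk, -⟩)
  · exact lt_irrefl _ h
  · exact lt_irrefl _ hk

theorem VarRevlexGt.quadratic {V : Type*} {vgt : V → V → Prop}
    (hirrefl : ∀ x, ¬ vgt x x) (htrans : ∀ {x y z}, vgt x y → vgt y z → vgt x z)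
    (htotal : ∀ {x y}, x ≠ y → vgt x y ∨ vgt y x) {u v u' v' : V}
    (hu : vgt u v') (hv : vgt v v') :
    VarRevlexGt vgt (Finsupp.single u 1 + Finsupp.single v 1)
      (Finsupp.single u' 1 + Finsupp.single v' 1) := by
  classical
  right
  constructor
  · simp [Finsupp.sum_add_index']
  have aux : ∀ k, vgt u k → vgt v k → (k = u' ∨ k = v') →
      (k = u' ∨ vgt u' k) → (k = v' ∨ vgt v' k) →
      ∃ k, (Finsupp.single u 1 + Finsupp.single v 1 : V →₀ ℕ) k <
        (Finsupp.single u' 1 + Finsupp.single v' 1 : V →₀ ℕ) k ∧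
        ∀ l, vgt k l → (Finsupp.single u 1 + Finsupp.single v 1 : V →₀ ℕ) l =
          (Finsupp.single u' 1 + Finsupp.single v' 1 : V →₀ ℕ) l := by
    intro k huk hvk hk hk1 hk2
    refine ⟨k, ?_, fun l hl => ?_⟩
    · simp only [Finsupp.add_apply, Finsupp.single_apply]
      grind
    · simp only [Finsupp.add_apply, Finsupp.single_apply]
      have h1 : u ≠ l := fun e => hirrefl _ (htrans hl (e ▸ huk))
      have h2 : v ≠ l := fun e => hirrefl _ (htrans hl (e ▸ hvk))
      have h3 : u' ≠ l := by grind
      have h4 : v' ≠ l := by grind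
      simp [h1, h2, h3, h4]
  by_cases h : u' = v'
  · exact aux v' hu hv (Or.inr rfl) (Or.inl h.symm) (Or.inl rfl)
  · rcases htotal h with h | h
    · exact aux v' hu hv (Or.inr rfl) (Or.inr h) (Or.inl rfl)
    · exact aux u' (htrans hu h) (htrans hv h) (Or.inl rfl) (Or.inl rfl) (Or.inr h)

section Generators

variable {n : ℕ} {a b c d : Fin n}

theorem exists_eq_single_add_single_of_mem (h1 : c < a) (h2 : a ≤ b) {m : Fin n →₀ ℕ}
    (hm : m ∈ BM a b ∪ BN b c d) :
    ∃ i j : Fin n, i ≤ j ∧ m = Finsupp.single i 1 + Finsupp.single j 1 := by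
  rcases hm with ⟨i, j, hij, -, -, rfl⟩ | ⟨i, j, hi, hj, -, rfl⟩
  · exact ⟨i, j, hij, rfl⟩
  · exact ⟨i, j, by order, rfl⟩

theorem single_add_single_mem_BM (h2 : a ≤ b) {i j : Fin n} (hi : i ≤ a) (hj : j ≤ b) :
    (Finsupp.single i 1 + Finsupp.single j 1 : Fin n →₀ ℕ) ∈ BM a b := by
  rcases le_total i j with h | h
  · exact ⟨i, j, h, hi, hj, rfl⟩
  · exact ⟨j, i, h, h.trans hi, hi.trans h2, add_comm _ _⟩

/-- The exchange property of the generators: a variable `x_p` dividing a generator may be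
replaced by any `x_i` with `i < p`. -/
theorem exists_exchange (h1 : c < a) (h2 : a ≤ b) {m : Fin n →₀ ℕ}
    (hm : m ∈ BM a b ∪ BN b c d) {i p : Fin n} (hi : i < p) (hp : m p ≠ 0) :
    ∃ e : Fin n, m = Finsupp.single p 1 + Finsupp.single e 1 ∧
      (Finsupp.single i 1 + Finsupp.single e 1 : Fin n →₀ ℕ) ∈ BM a b ∪ BN b c d := by
  rcases hm with ⟨r, t, hrt, hr, ht, rfl⟩ | ⟨r, t, hr, hbt, htd, rfl⟩
  all_goals
    have hcase : p = r ∨ p = t := by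
      simp only [Finsupp.add_apply, Finsupp.single_apply] at hp
      grind
  · rcases hcase with rfl | rfl
    · exact ⟨t, rfl, Or.inl (single_add_single_mem_BM h2 (hi.le.trans hr) ht)⟩
    · refine ⟨r, add_comm _ _, Or.inl ?_⟩
      rw [add_comm]
      exact single_add_single_mem_BM h2 hr (hi.le.trans ht)
  · rcases hcase with rfl | rfl
    · exact ⟨t, rfl, Or.inr ⟨i, t, hi.le.trans hr, hbt, htd, rfl⟩⟩
    · refine ⟨r, add_comm _ _, ?_⟩
      rw [add_comm]
      rcases le_or_gt i b with hib | hib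
      · exact Or.inl (single_add_single_mem_BM h2 (hr.trans h1.le) hib)
      · exact Or.inr ⟨r, i, hr, hib, hi.le.trans htd, rfl⟩

/-- The multidegree of a monomial in the variables indexed by a set of monomials. -/
noncomputable abbrev multidegree (S : Set (Fin n →₀ ℕ)) : (↥S →₀ ℕ) →ₗ[ℕ] (Fin n →₀ ℕ) :=
  Finsupp.linearCombination ℕ Subtype.val

theorem exists_factor_of_multidegree_apply_ne_zero {S : Set (Fin n →₀ ℕ)} {T : ↥S →₀ ℕ}
    {q : Fin n} (h : multidegree S T q ≠ 0) : ∃ u ∈ T.support, (u : Fin n →₀ ℕ) q ≠ 0 := by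
  by_contra! hc
  apply h
  rw [Finsupp.linearCombination_apply, Finsupp.sum, Finsupp.finsetSum_apply]
  exact Finset.sum_eq_zero fun u hu => by simp [hc u hu]

theorem exists_head_le (h1 : c < a) (h2 : a ≤ b) {T : ↥(BM a b ∪ BN b c d) →₀ ℕ}
    {w : ↥(BM a b ∪ BN b c d)} (hw : (w : Fin n →₀ ℕ) ≤ multidegree _ T)
    (hT : ∀ u ∈ T.support, RlexGt (u : Fin n →₀ ℕ) (w : Fin n →₀ ℕ)) :
    ∃ g ∈ G1 a b c d, g.head ≤ T := by
  classical
  obtain ⟨p, q, hpq, hwpq⟩ := exists_eq_single_add_single_of_mem h1 h2 w.2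
  have hwq := hw q
  have hwp := hw p
  rw [hwpq] at hwq hwp
  obtain ⟨u, hu, huq⟩ := exists_factor_of_multidegree_apply_ne_zero (T := T) (q := q) (by
    simp only [Finsupp.add_apply, Finsupp.single_apply] at hwq
    grind)
  have huw := hT u hu
  obtain ⟨i, t, hit, hu'⟩ := exists_eq_single_add_single_of_mem h1 h2 u.2
  rw [hu', hwpq] at huw
  rw [hu'] at huq
  obtain ⟨hip, rfl⟩ := huw.exists_lt_of_apply_ne_zero hit hpq huq
  have hle : Finsupp.single u 1 ≤ T := by
    rw [Finsupp.single_le_iff]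
    exact Nat.one_le_iff_ne_zero.mpr (Finsupp.mem_support_iff.mp hu)
  obtain ⟨R, rfl⟩ := exists_add_of_le hle
  obtain ⟨v, hv, hvp⟩ := exists_factor_of_multidegree_apply_ne_zero (T := R) (q := p) (by
    rw [map_add, Finsupp.linearCombination_single, one_smul, hu'] at hwp
    simp only [Finsupp.add_apply, Finsupp.single_apply] at hwp
    grind)
  obtain ⟨e, hve, hmem⟩ := exists_exchange h1 h2 v.2 hip hvp
  have hvw : RlexGt (v : Fin n →₀ ℕ) (w : Fin n →₀ ℕ) := hT v (by
    rw [Finsupp.mem_support_iff] at hv ⊢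
    simp [hv])
  refine ⟨⟨Finsupp.single u 1 + Finsupp.single v 1, Finsupp.single ⟨_, hmem⟩ 1 +
    Finsupp.single w 1⟩, ⟨u, v, ⟨_, hmem⟩, w, ?_, hT u hu, hvw, rfl, rfl⟩, ?_⟩
  · rw [hu', hve, hwpq]
    ext x
    simp only [Finsupp.add_apply]
    omega
  · refine add_le_add_right ?_ _
    rw [Finsupp.single_le_iff]
    exact Nat.one_le_iff_ne_zero.mpr (Finsupp.mem_support_iff.mp hv)

theorem degree_multidegree (h1 : c < a) (h2 : a ≤ b) (T : ↥(BM a b ∪ BN b c d) →₀ ℕ) :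
    (multidegree _ T).degree = 2 * T.sum fun _ e => e := by
  rw [Finsupp.linearCombination_apply, Finsupp.sum, map_sum, Finsupp.sum, Finset.mul_sum]
  refine Finset.sum_congr rfl fun u _ => ?_
  obtain ⟨i, j, -, hu⟩ := exists_eq_single_add_single_of_mem h1 h2 u.2
  rw [map_nsmul, hu, map_add, Finsupp.degree_single, Finsupp.degree_single, smul_eq_mul,
    mul_comm]

theorem exists_head_le_of_varRevlexGt (h1 : c < a) (h2 : a ≤ b)
    {m m' : ↥(BM a b ∪ BN b c d) →₀ ℕ} (hm : multidegree _ m = multidegree _ m')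
    (hgt : VarRevlexGt (fun w w' : ↥(BM a b ∪ BN b c d) =>
      RlexGt (w : Fin n →₀ ℕ) (w' : Fin n →₀ ℕ)) m m') :
    ∃ g ∈ G1 a b c d, g.head ≤ m := by
  have hdeg := degree_multidegree h1 h2 m
  rw [hm, degree_multidegree h1 h2 m'] at hdeg
  obtain hlt | ⟨-, w, hw, hsmaller⟩ := hgt
  · omega
  have hfib : multidegree _ (m - m') = multidegree _ (m' - m) := by
    have h : m' - m + m = m - m' + m' := by
      ext x
      simp only [Finsupp.add_apply, Finsupp.tsub_apply]
      omega
    have h' := congrArg (multidegree _) h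
    rw [map_add, map_add, hm] at h'
    exact (add_right_cancel h').symm
  obtain ⟨g, hg, hle⟩ := exists_head_le (T := m - m') (w := w) h1 h2 (by
      have hwle : Finsupp.single w 1 ≤ m' - m := by
        rw [Finsupp.single_le_iff, Finsupp.tsub_apply]
        omega
      obtain ⟨R, hR⟩ := exists_add_of_le hwle
      rw [hfib, hR, map_add, Finsupp.linearCombination_single, one_smul]
      exact le_self_add) fun u hu => by
    rw [Finsupp.mem_support_iff, Finsupp.tsub_apply] at hu
    have hne : u ≠ w := by
      rintro rfl
      omega
    refine (RlexGt.total (Subtype.coe_ne_coe.mpr hne)).resolve_right fun hwu => ?_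
    have := hsmaller u hwu
    omega
  exact ⟨g, hg, hle.trans tsub_le_self⟩

theorem VarRevlexGt.of_mem_G1 {g : MarkedBinomial ↥(BM a b ∪ BN b c d)} (hg : g ∈ G1 a b c d) :
    VarRevlexGt (fun w w' : ↥(BM a b ∪ BN b c d) =>
      RlexGt (w : Fin n →₀ ℕ) (w' : Fin n →₀ ℕ)) g.head g.tail := by
  obtain ⟨u, v, u', v', -, hu, hv, hhead, htail⟩ := hg
  rw [hhead, htail]
  apply VarRevlexGt.quadratic
  · exact fun x => RlexGt.irrefl _
  · exact RlexGt.trans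
  · exact fun h => RlexGt.total (Subtype.coe_ne_coe.mpr h)
  · exact hu
  · exact hv

end Generators

theorem isInitialTerm_toPoly_s5 {V K : Type*} [Field K] {gt : (V →₀ ℕ) → (V →₀ ℕ) → Prop}
    {g : MarkedBinomial V} (hgt : gt g.head g.tail) (hne : g.head ≠ g.tail) :
    IsInitialTerm gt (g.toPoly K) g.head := by
  classical
  constructor
  · simp [MarkedBinomial.toPoly, MvPolynomial.coeff_monomial, hne.symm]
  · intro m' hm' hm'h
    rw [MvPolynomial.mem_support_iff, MarkedBinomial.toPoly, MvPolynomial.coeff_sub,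
      MvPolynomial.coeff_monomial, MvPolynomial.coeff_monomial, if_neg hm'h.symm] at hm'
    have : g.tail = m' := by
      by_contra hc
      simp [hc] at hm'
    rwa [← this]

section MonomialMap

variable {n : ℕ} {K : Type*} [Field K] {S : Set (Fin n →₀ ℕ)}

theorem aeval_monomial_eq_monomial_multidegree (m : ↥S →₀ ℕ) (r : K) :
    MvPolynomial.aeval (fun w : ↥S => MvPolynomial.monomial (w : Fin n →₀ ℕ) (1 : K))
      (MvPolynomial.monomial m r) = MvPolynomial.monomial (multidegree S m) r := by
  rw [MvPolynomial.aeval_monomial, Finsupp.linearCombination_apply, Finsupp.sum,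
    MvPolynomial.monomial_sum_index]
  simp [Finsupp.prod, MvPolynomial.monomial_pow, MvPolynomial.algebraMap_eq]

/-- A term of a polynomial in the toric ideal cannot be alone in its multidegree. -/
theorem exists_ne_multidegree_eq_of_aeval_eq_zero {f : MvPolynomial ↥S K}
    (hf : MvPolynomial.aeval
      (fun w : ↥S => MvPolynomial.monomial (w : Fin n →₀ ℕ) (1 : K)) f = 0)
    {m : ↥S →₀ ℕ} (hm : m ∈ f.support) :
    ∃ m' ∈ f.support, m' ≠ m ∧ multidegree S m = multidegree S m' := by
  classical
  by_contra! hc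
  rw [f.as_sum, map_sum] at hf
  have hcoeff := congrArg (MvPolynomial.coeff (multidegree S m)) hf
  simp only [aeval_monomial_eq_monomial_multidegree, MvPolynomial.coeff_sum,
    MvPolynomial.coeff_monomial, MvPolynomial.coeff_zero] at hcoeff
  rw [Finset.sum_eq_single_of_mem m hm fun m' hm' hne => if_neg (hc m' hm' hne).symm,
    if_pos rfl] at hcoeff
  exact MvPolynomial.mem_support_iff.mp hm hcoeff

end MonomialMap

/-- For the strongly stable ideal `I = B(x_a x_b, x_c x_d)` with
`c < a ≤ b < d`, the collection `G₁ = {T_u T_v − T_{u'} T_{v'} : uv = u'v', u, v ≻_rlex v'}`,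
marked at `T_u T_v`, is a Gröbner basis of the toric ideal `T(I) = ker φ_I` with respect
to the reverse lexicographic order on `K[T_u : u ∈ B_M ∪ B_N]` induced by the variable
order `T_u > T_v ⟺ u ≻_rlex v`, with the marked terms as initial terms. -/
theorem G1_is_revlex_GroebnerBasis {n : ℕ} {K : Type} [Field K] (a b c d : Fin n)
    (h1 : c < a) (h2 : a ≤ b) (h3 : b < d)
    (φ : MvPolynomial ↥(BM a b ∪ BN b c d) K →ₐ[K] MvPolynomial (Fin n) K)
    (hφ : φ = MvPolynomial.aeval fun w : ↥(BM a b ∪ BN b c d) =>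
      MvPolynomial.monomial (w : Fin n →₀ ℕ) (1 : K)) :
    IsMarkedGB
      (VarRevlexGt fun w w' : ↥(BM a b ∪ BN b c d) =>
        RlexGt (w : Fin n →₀ ℕ) (w' : Fin n →₀ ℕ))
      (G1 a b c d) (RingHom.ker φ.toRingHom) := by
  subst hφ
  have hmem : ∀ g ∈ G1 a b c d, g.toPoly K ∈ RingHom.ker (MvPolynomial.aeval
      fun w : ↥(BM a b ∪ BN b c d) =>
        MvPolynomial.monomial (w : Fin n →₀ ℕ) (1 : K)).toRingHom := by
    rintro g ⟨u, v, u', v', huv, -, -, hhead, htail⟩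
    simp only [RingHom.mem_ker, AlgHom.toRingHom_eq_coe, RingHom.coe_coe]
    rw [MarkedBinomial.toPoly, map_sub, aeval_monomial_eq_monomial_multidegree,
      aeval_monomial_eq_monomial_multidegree, hhead, htail]
    simp [huv]
  refine ⟨hmem, fun g hg => VarRevlexGt.of_mem_G1 hg, le_antisymm ?_ ?_⟩
  · rw [Ideal.span_le]
    rintro _ ⟨g, hg, rfl⟩
    have hgt := VarRevlexGt.of_mem_G1 hg
    have hne : g.head ≠ g.tail := fun h => VarRevlexGt.irrefl _ _ (h ▸ hgt)
    have hinit := isInitialTerm_toPoly_s5 (K := K) hgt hne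
    exact Ideal.subset_span ⟨g.toPoly K, hmem g hg,
      MvPolynomial.ne_zero_iff.mpr ⟨_, MvPolynomial.mem_support_iff.mp hinit.1⟩, _, hinit, rfl⟩
  · rw [Ideal.span_le]
    rintro _ ⟨f, hf, -, m, ⟨hm, hlead⟩, rfl⟩
    obtain ⟨m', hm', hne, hfib⟩ := exists_ne_multidegree_eq_of_aeval_eq_zero hf hm
    obtain ⟨g, hg, hle⟩ := exists_head_le_of_varRevlexGt h1 h2 hfib (hlead m' hm' hne)
    obtain ⟨R, rfl⟩ := exists_add_of_le hle
    rw [show MvPolynomial.monomial (g.head + R) (1 : K) =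
      MvPolynomial.monomial R 1 * MvPolynomial.monomial g.head 1 by
        rw [MvPolynomial.monomial_mul, one_mul, add_comm]]
    exact Ideal.mul_mem_left _ _ (Ideal.subset_span ⟨g, hg, rfl⟩)
end
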